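/- For every game structure (user set I, block producer set J, transaction sets S_j ⊆ I, block size k), the collection of feasible transaction subsets forms a matroid over I, where A ⊆ I is feasible if there exists an assignment of the transactions in A to blocks B_1, …, B_m with B_j ⊆ S_j, |B_j| ≤ k, and A = B_1 ∪ ⋯ ∪ B_m with the B_j disjoint. -/

import Mathlib

/-- A subset `A` of transactions is feasible for the game structure
`(I, J = Fin m, S, k)` if it can be partitioned into pairwise disjoint blocks
`B_1, …, B_m` with `B_j ⊆ S_j` and `|B_j| ≤ k`. -/
def Feasible {ι : Type*} [DecidableEq ι] {m : ℕ} (S : Fin m → Finset ι) (k : ℕ)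
    (A : Finset ι) : Prop :=
  ∃ B : Fin m → Finset ι,
    (∀ j, B j ⊆ S j ∧ (B j).card ≤ k) ∧
    (∀ j j', j ≠ j' → Disjoint (B j) (B j')) ∧
    A = Finset.univ.biUnion B

/-- If `B` and `B'` are block assignments of `A` and `A'` and `A` is smaller than `A'`, then `A`
can be enlarged by an element of `A'`. The induction is on the number of elements of `A'` that the
two assignments treat differently. -/
theorem exists_feasible_insert {ι : Type*} [DecidableEq ι] {m : ℕ} (S : Fin m → Finset ι) (k : ℕ)
    {B' : Fin m → Finset ι} (hS' : ∀ j, B' j ⊆ S j ∧ (B' j).card ≤ k)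
    (hd' : ∀ j j', j ≠ j' → Disjoint (B' j) (B' j')) (A : Finset ι)
    (hlt : A.card < (Finset.univ.biUnion B').card) (n : ℕ) :
    ∀ B : Fin m → Finset ι, (∀ j, B j ⊆ S j ∧ (B j).card ≤ k) →
      (∀ j j', j ≠ j' → Disjoint (B j) (B j')) → A = Finset.univ.biUnion B →
      ∑ j, (B' j \ B j).card ≤ n →
      ∃ x ∈ Finset.univ.biUnion B' \ A, Feasible S k (insert x A) := by
  induction n with
  | zero =>
    intro B _ _ hA hn
    have hsub : ∀ j, B' j ⊆ B j := by simpa [Finset.sum_eq_zero_iff] using hn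
    have := Finset.card_le_card (Finset.biUnion_mono fun j (_ : j ∈ Finset.univ) => hsub j)
    rw [← hA] at this
    omega
  | succ n ih =>
    intro B hS hd hA hn
    have hsum : ∑ j, (B j).card < ∑ j, (B' j).card := by
      rwa [hA, Finset.card_biUnion fun i _ j _ h => hd i j h,
        Finset.card_biUnion fun i _ j _ h => hd' i j h] at hlt
    obtain ⟨j, -, hj⟩ := Finset.exists_lt_of_sum_lt hsum
    obtain ⟨x, hx', hx⟩ := Finset.exists_mem_notMem_of_card_lt_card hj
    let C : Fin m → Finset ι := fun i => if i = j then insert x (B i) else (B i).erase x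
    have hCS : ∀ i, C i ⊆ S i ∧ (C i).card ≤ k := by
      intro i
      by_cases h : i = j
      · subst h
        simp only [C, if_true]
        refine ⟨Finset.insert_subset ((hS' i).1 hx') (hS i).1, ?_⟩
        have := Finset.card_insert_le x (B i)
        have := (hS' i).2
        omega
      · simp only [C, h, if_false]
        exact ⟨(Finset.erase_subset _ _).trans (hS i).1, Finset.card_erase_le.trans (hS i).2⟩
    have hCd : ∀ i i', i ≠ i' → Disjoint (C i) (C i') := by
      intro i i' hii
      have := hd i i' hii
      rw [Finset.disjoint_left] at this ⊢
      intro y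
      grind
    have hCA : insert x A = Finset.univ.biUnion C := by
      ext y
      rw [hA]
      simp only [Finset.mem_insert, Finset.mem_biUnion, Finset.mem_univ, true_and]
      constructor
      · rintro (rfl | ⟨i, hi⟩)
        · exact ⟨j, by simp [C]⟩
        · by_cases hy : y = x
          · exact ⟨j, by simp [C, hy]⟩
          · exact ⟨i, by grind⟩
      · rintro ⟨i, hi⟩
        by_cases hy : y = x
        · exact Or.inl hy
        · exact Or.inr ⟨i, by grind⟩
    by_cases hxA : x ∈ A
    · refine ih C hCS hCd (by rwa [Finset.insert_eq_of_mem hxA] at hCA) ?_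
      have hC : ∑ i, (B' i \ C i).card < ∑ i, (B' i \ B i).card := by
        refine Finset.sum_lt_sum (fun i _ => Finset.card_le_card ?_)
          ⟨j, Finset.mem_univ j, Finset.card_lt_card ?_⟩
        · intro y hy
          by_cases h : i = j
          · grind
          · have := Finset.disjoint_left.1 (hd' j i (Ne.symm h)) hx'
            grind
        · rw [Finset.ssubset_iff_of_subset (fun y hy => by grind)]
          exact ⟨x, by grind⟩
      omega
    · exact ⟨x, by simpa [hxA] using ⟨j, hx'⟩, C, hCS, hCd, hCA⟩

/-- For every game structure, the collection of feasible transaction subsets forms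
a matroid over `I`: it is nonempty, downward closed, and satisfies the exchange
property. -/
theorem feasible_is_matroid {ι : Type*} [DecidableEq ι] [Fintype ι] {m : ℕ}
    (S : Fin m → Finset ι) (k : ℕ) :
    (∃ A, Feasible S k A) ∧
    (∀ ⦃A A' : Finset ι⦄, Feasible S k A' → A ⊆ A' → Feasible S k A) ∧
    (∀ ⦃A A' : Finset ι⦄, Feasible S k A → Feasible S k A' → A.card < A'.card →
      ∃ x ∈ A' \ A, Feasible S k (insert x A)) := by
  refine ⟨⟨∅, fun _ => ∅, by simp, by simp, by ext; simp⟩, ?_, ?_⟩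
  · rintro A _ ⟨B, hS, hd, rfl⟩ hA
    refine ⟨fun j => B j ∩ A, fun j => ⟨Finset.inter_subset_left.trans (hS j).1,
      (Finset.card_le_card Finset.inter_subset_left).trans (hS j).2⟩, fun i j h =>
      (hd i j h).mono Finset.inter_subset_left Finset.inter_subset_left, ?_⟩
    rw [← Finset.biUnion_inter, Finset.inter_eq_right.2 hA]
  · rintro A _ ⟨B, hS, hd, hA⟩ ⟨B', hS', hd', rfl⟩ hlt
    exact exists_feasible_insert S k hS' hd' A hlt _ B hS hd hA le_rfl
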